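/- If a digraph F embeds into every digraph D with uncountable dichromatic number, then the underlying undirected graph of F (with an edge {u,v} whenever (u,v) or (v,u) is an arc of F) is bipartite. -/

import Mathlib

/-- A digraph on a vertex set `verts`: arcs go between vertices of `verts`,
there are no loops and no pair of opposite arcs. -/
structure Digraph' (V : Type*) where
  verts : Set V
  Arc : V → V → Prop
  arc_left : ∀ ⦃u v : V⦄, Arc u v → u ∈ verts
  arc_right : ∀ ⦃u v : V⦄, Arc u v → v ∈ verts
  irrefl' : ∀ v : V, ¬ Arc v v
  asymm' : ∀ u v : V, Arc u v → ¬ Arc v u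

namespace Digraph'

variable {V : Type*} {W : Type*}

/-- A directed cycle of length `m` (with `m ≥ 1`) with respect to the arc relation `E`,
all of whose vertices lie in `A`. -/
def RelDicycle (E : V → V → Prop) (A : Set V) (m : ℕ) (c : ZMod m → V) : Prop :=
  1 ≤ m ∧ Function.Injective c ∧ (∀ i, c i ∈ A) ∧ ∀ i, E (c i) (c (i + 1))

/-- The arc relation `E` has no directed cycle of length `≤ k`, i.e. digirth `> k`. -/
def RelDigirthGT (E : V → V → Prop) (k : ℕ) : Prop :=
  ∀ m ≤ k, ∀ c : ZMod m → V, ¬ RelDicycle E Set.univ m c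

/-- A directed cycle of length `m` in the digraph `D`, all of whose vertices lie in `A`. -/
def DicycleIn (D : Digraph' V) (A : Set V) (m : ℕ) (c : ZMod m → V) : Prop :=
  RelDicycle D.Arc A m c

/-- The digraph `D` has digirth `> k`. -/
def DigirthGT (D : Digraph' V) (k : ℕ) : Prop :=
  RelDigirthGT D.Arc k

/-- `A` is an acyclic set of vertices of `D`: the subdigraph induced on `A`
contains no directed cycle. -/
def AcyclicSet (D : Digraph' V) (A : Set V) : Prop :=
  ∀ m c, ¬ D.DicycleIn A m c

/-- `D` has uncountable dichromatic number: its vertex set cannot be covered by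
countably many acyclic sets. -/
def UncountableDichromatic (D : Digraph' V) : Prop :=
  ¬ ∃ F : ℕ → Set V, (∀ n, D.AcyclicSet (F n)) ∧ D.verts ⊆ ⋃ n, F n

/-- The dichromatic number of `D` is at most `μ`: the vertex set can be covered by
at most `μ` many acyclic sets. -/
def DichromaticLE (D : Digraph' V) (μ : Cardinal) : Prop :=
  ∃ 𝒜 : Set (Set V), Cardinal.mk 𝒜 ≤ μ ∧ (∀ A ∈ 𝒜, D.AcyclicSet A) ∧ D.verts ⊆ ⋃₀ 𝒜

/-- The subdigraph of `D` induced on the set `A`. -/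
def induce (D : Digraph' V) (A : Set V) : Digraph' V where
  verts := D.verts ∩ A
  Arc u v := D.Arc u v ∧ u ∈ A ∧ v ∈ A
  arc_left := fun _ _ h => ⟨D.arc_left h.1, h.2.1⟩
  arc_right := fun _ _ h => ⟨D.arc_right h.1, h.2.2⟩
  irrefl' := fun v h => D.irrefl' v h.1
  asymm' := fun u v h h' => D.asymm' u v h.1 h'.1

/-- `D₀` embeds into `D`: an injective map of the vertices carrying arcs to arcs
(the copy need not be induced). -/
def Embeds (D₀ : Digraph' W) (D : Digraph' V) : Prop :=
  ∃ f : W → V, Set.InjOn f D₀.verts ∧ Set.MapsTo f D₀.verts D.verts ∧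
    ∀ ⦃u v : W⦄, D₀.Arc u v → D.Arc (f u) (f v)

/-- The reverse of a digraph: all arcs are reversed. -/
def rev (D : Digraph' V) : Digraph' V where
  verts := D.verts
  Arc u v := D.Arc v u
  arc_left := fun _ _ h => D.arc_right h
  arc_right := fun _ _ h => D.arc_left h
  irrefl' := fun v h => D.irrefl' v h
  asymm' := fun u v h h' => D.asymm' v u h h'

end Digraph'

namespace Digraph'

universe u v

/-- For every type `C` of colours there is a linear order such that every colouring of lists gives
the same colour to two consecutive windows of length `n` of an increasing list. -/
lemma exists_linearOrder_monochromatic_shift (n : ℕ) (hn : 1 ≤ n) (C : Type u) :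
    ∃ (X : Type u) (_ : LinearOrder X), ∀ f : List X → C, ∃ z : List X,
      z.length = n + 1 ∧ z.Pairwise (· < ·) ∧ f z.dropLast = f z.tail := by
  induction n, hn using Nat.le_induction generalizing C with
  | base =>
    classical
    let _ : LinearOrder (Set C) := linearOrderOfSTO WellOrderingRel
    refine ⟨Set C, inferInstance, fun f => ?_⟩
    by_contra! hf
    refine Function.cantor_injective (fun a : Set C => f [a]) fun a b hab => ?_
    by_contra hne
    rcases lt_or_gt_of_ne hne with hlt | hlt
    · exact hf [a, b] rfl (by simpa using hlt) hab
    · exact hf [b, a] rfl (by simpa using hlt) hab.symm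
  | succ n hn ih =>
    obtain ⟨X, hX, hC⟩ := ih (Set C)
    refine ⟨X, hX, fun f => ?_⟩
    obtain ⟨z, hlen, hz, hf⟩ :=
      hC fun l => {c | ∃ a, (l ++ [a]).Pairwise (· < ·) ∧ f (l ++ [a]) = c}
    obtain ⟨x, t, rfl⟩ : ∃ x t, z = x :: t := List.exists_cons_of_length_eq_add_one hlen
    obtain ⟨m, y, rfl⟩ : ∃ m y, t = m ++ [y] := by
      have ht : t ≠ [] := by rintro rfl; simp at hlen; omega
      exact ⟨t.dropLast, t.getLast ht, (List.dropLast_append_getLast ht).symm⟩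
    have hdrop : (x :: (m ++ [y])).dropLast = x :: m := by
      rw [← List.cons_append, List.dropLast_concat]
    have hmem : f (x :: (m ++ [y])) ∈
        {c | ∃ a, ((m ++ [y]) ++ [a]).Pairwise (· < ·) ∧ f ((m ++ [y]) ++ [a]) = c} := by
      rw [hdrop, List.tail_cons] at hf
      rw [← hf]
      exact ⟨y, hz, rfl⟩
    obtain ⟨a, ha, hfa⟩ := hmem
    refine ⟨x :: (m ++ [y]) ++ [a], by simpa using hlen, ?_, ?_⟩
    · have hxy : x < y := (List.pairwise_cons.1 hz).1 y (by simp)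
      have hya : y < a := (List.pairwise_append.1 ha).2.2 y (by simp) a (by simp)
      rw [List.cons_append, List.pairwise_cons]
      refine ⟨fun b hb => ?_, ha⟩
      rcases List.mem_append.1 hb with hb | hb
      · exact (List.pairwise_cons.1 hz).1 b hb
      · rw [List.mem_singleton.1 hb]
        exact hxy.trans hya
    · rw [List.dropLast_concat, List.cons_append, List.tail_cons, hfa]

/-- If every colouring with colours `C × Prop × Prop` has a monochromatic arc, then every colouring
with colours `C` has a monochromatic path with three arcs. -/
lemma exists_monochromatic_path {V : Type*} {C : Type*} {R : V → V → Prop}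
    (hR : ∀ g : V → C × Prop × Prop, ∃ x y, R x y ∧ g x = g y) (f : V → C) :
    ∃ x₀ x₁ x₂ x₃, R x₀ x₁ ∧ R x₁ x₂ ∧ R x₂ x₃ ∧ f x₀ = f x₁ ∧ f x₁ = f x₂ ∧ f x₂ = f x₃ := by
  obtain ⟨x, y, hxy, h⟩ := hR fun x => (f x, (∃ y, R x y ∧ f x = f y),
    ∃ y z, R x y ∧ R y z ∧ f x = f y ∧ f y = f z)
  simp only [Prod.mk.injEq] at h
  obtain ⟨hf, h₁, h₂⟩ := h
  obtain ⟨z, hyz, hf'⟩ := h₁.mp ⟨y, hxy, hf⟩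
  obtain ⟨a, b, ha, hb, hfa, hfb⟩ := h₂.mp ⟨y, z, hxy, hyz, hf, hf'⟩
  exact ⟨x, y, a, b, hxy, ha, hb, hf, hfa, hfb⟩

/-- `y` arises from `x` by dropping the first `k` entries and adding new ones at the end. -/
def IsShift {X : Type*} (n k : ℕ) (x y : List X) : Prop :=
  ∀ i, i + k < n → y[i]? = x[i + k]?

/-- `y` is `x` translated by `d`, up to the first `m` and the last `m` entries. -/
def IsDisplaced {X : Type*} (n m : ℕ) (d : ℤ) (x y : List X) : Prop :=
  ∀ i j : ℕ, m ≤ i → i + m < n → (j : ℤ) = i + d → y[i]? = x[j]?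

section

variable {X : Type*} {n m m' j k : ℕ} {d d' : ℤ} {x y z : List X}

lemma IsShift.trans (h : IsShift n j x y) (h' : IsShift n k y z) : IsShift n (j + k) x z := by
  intro i hi
  rw [h' i (by omega), h (i + k) (by omega)]
  congr 1
  omega

lemma IsShift.isDisplaced (h : IsShift n k x y) (hk : k ≤ m) : IsDisplaced n m k x y := by
  intro i l _ _ hl
  obtain rfl : l = i + k := by omega
  exact h i (by omega)

lemma IsShift.isDisplaced_neg (h : IsShift n k x y) (hk : k ≤ m) :
    IsDisplaced n m (-k) y x := by
  intro i l _ _ hl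
  obtain rfl : i = l + k := by omega
  exact (h l (by omega)).symm

lemma IsDisplaced.trans (h : IsDisplaced n m d x y) (h' : IsDisplaced n m' d' y z)
    (hd : |d'| ≤ m') : IsDisplaced n (m + m') (d + d') x z := by
  intro i l _ _ hl
  have hd' := abs_le.1 hd
  obtain ⟨p, hp⟩ : ∃ p : ℕ, (p : ℤ) = i + d' := ⟨(i + d').toNat, by omega⟩
  rw [h' i p (by omega) (by omega) hp, h p l (by omega) (by omega) (by omega)]

lemma IsDisplaced.eq_zero [LinearOrder X] (h : IsDisplaced n m d x x) (hd : |d| ≤ m)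
    (hm : m + m < n) (hlen : x.length = n) (hx : x.Pairwise (· < ·)) : d = 0 := by
  have hd' := abs_le.1 hd
  obtain ⟨p, hp⟩ : ∃ p : ℕ, (p : ℤ) = m + d := ⟨(m + d).toNat, by omega⟩
  have hnodup : x.Nodup := hx.imp fun h => h.ne
  have := (List.getElem?_inj (i := m) (by omega) hnodup).1 (h m p le_rfl hm hp)
  omega

end

/-- The digraph on increasing lists of length `n` whose arcs are the shifts by `1` and the
reversed shifts by `3`. -/
def shiftDigraph (X : Type u) [LinearOrder X] (n : ℕ) (hn : 12 < n) : Digraph' (List X) where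
  verts := {x | x.length = n ∧ x.Pairwise (· < ·)}
  Arc x y := (x.length = n ∧ x.Pairwise (· < ·)) ∧ (y.length = n ∧ y.Pairwise (· < ·)) ∧
    (IsShift n 1 x y ∨ IsShift n 3 y x)
  arc_left := fun _ _ h => h.1
  arc_right := fun _ _ h => h.2.1
  irrefl' := by
    rintro x ⟨⟨hlen, hx⟩, -, h | h⟩ <;>
    · have := (h.isDisplaced (m := 3) (by omega)).eq_zero (by simp) (by omega) hlen hx
      omega
  asymm' := by
    rintro x y ⟨⟨hlen, hx⟩, -, h | h⟩ ⟨-, -, h' | h'⟩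
    · have := ((h.isDisplaced (m := 3) (by omega)).trans
        (h'.isDisplaced (m := 3) (by omega)) (by simp)).eq_zero (by norm_num) (by omega) hlen hx
      omega
    · have := ((h.isDisplaced (m := 3) (by omega)).trans
        (h'.isDisplaced_neg (m := 3) (by omega)) (by simp)).eq_zero (by norm_num) (by omega) hlen hx
      omega
    · have := ((h.isDisplaced_neg (m := 3) (by omega)).trans
        (h'.isDisplaced (m := 3) (by omega)) (by simp)).eq_zero (by norm_num) (by omega) hlen hx
      omega
    · have := ((h.isDisplaced_neg (m := 3) (by omega)).trans
        (h'.isDisplaced_neg (m := 3) (by omega)) (by simp)).eq_zero (by norm_num) (by omega) hlen hx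
      omega

lemma shiftDigraph_adj_isDisplaced {X : Type u} [LinearOrder X] {n : ℕ} {hn : 12 < n}
    {x y : List X} (h : (shiftDigraph X n hn).Arc x y ∨ (shiftDigraph X n hn).Arc y x) :
    ∃ d : ℤ, |d| ≤ 3 ∧ Odd d ∧ IsDisplaced n 3 d x y := by
  rcases h with ⟨-, -, h | h⟩ | ⟨-, -, h | h⟩
  · exact ⟨1, by norm_num, by decide, h.isDisplaced (by omega)⟩
  · exact ⟨-3, by norm_num, by decide, h.isDisplaced_neg (by omega)⟩
  · exact ⟨-1, by norm_num, by decide, h.isDisplaced_neg (by omega)⟩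
  · exact ⟨3, by norm_num, by decide, h.isDisplaced (by omega)⟩

/-- For a suitable linear order `X`, the shift digraph has uncountable dichromatic number. -/
lemma exists_uncountableDichromatic_shiftDigraph (n : ℕ) (hn : 12 < n) :
    ∃ (X : Type u) (_ : LinearOrder X), (shiftDigraph X n hn).UncountableDichromatic := by
  obtain ⟨X, hX, hC⟩ :=
    exists_linearOrder_monochromatic_shift n (by omega) (ULift.{u} ℕ × Prop × Prop)
  refine ⟨X, hX, ?_⟩
  rintro ⟨F, hF, hcov⟩
  have hcov' : ∀ x : List X, ∃ i, x.length = n ∧ x.Pairwise (· < ·) → x ∈ F i := by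
    intro x
    by_cases hx : x.length = n ∧ x.Pairwise (· < ·)
    · obtain ⟨i, hi⟩ := Set.mem_iUnion.1 (hcov hx)
      exact ⟨i, fun _ => hi⟩
    · exact ⟨0, fun h => absurd h hx⟩
  choose c hc using hcov'
  let R : List X → List X → Prop := fun x y =>
    (x.length = n ∧ x.Pairwise (· < ·)) ∧ (y.length = n ∧ y.Pairwise (· < ·)) ∧ IsShift n 1 x y
  have hR : ∀ g : List X → ULift.{u} ℕ × Prop × Prop, ∃ x y, R x y ∧ g x = g y := by
    intro g
    obtain ⟨z, hlen, hz, hg⟩ := hC g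
    refine ⟨z.dropLast, z.tail, ⟨⟨by simp [hlen], hz.sublist z.dropLast_sublist⟩,
      ⟨by simp [hlen], hz.sublist z.tail_sublist⟩, fun i hi => ?_⟩, hg⟩
    simp [List.getElem?_tail, hlen, hi]
  obtain ⟨x₀, x₁, x₂, x₃, h₀, h₁, h₂, e₀, e₁, e₂⟩ :=
    exists_monochromatic_path hR fun x => ULift.up (c x)
  simp only [ULift.up.injEq] at e₀ e₁ e₂
  have hne : ∀ {x y : List X} {k : ℕ}, x.length = n ∧ x.Pairwise (· < ·) → 1 ≤ k → k ≤ 3 →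
      IsShift n k x y → x ≠ y := by
    rintro x _ k ⟨hlen, hx⟩ hk hk' h rfl
    have := (h.isDisplaced hk').eq_zero (by simpa using hk') (by omega) hlen hx
    omega
  have s₀₂ := h₀.2.2.trans h₁.2.2
  have s₁₃ := h₁.2.2.trans h₂.2.2
  have s₀₃ := s₀₂.trans h₂.2.2
  have n₀₁ := hne h₀.1 (by omega) (by omega) h₀.2.2
  have n₁₂ := hne h₁.1 (by omega) (by omega) h₁.2.2
  have n₂₃ := hne h₂.1 (by omega) (by omega) h₂.2.2
  have n₀₂ := hne h₀.1 (by omega) (by omega) s₀₂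
  have n₁₃ := hne h₁.1 (by omega) (by omega) s₁₃
  have n₀₃ := hne h₀.1 (by omega) (by omega) s₀₃
  refine hF (c x₀) 4 (![x₀, x₁, x₂, x₃] : Fin 4 → List X) ⟨by omega, ?_, ?_, ?_⟩
  · change Function.Injective (![x₀, x₁, x₂, x₃] : Fin 4 → List X)
    intro i j
    fin_cases i <;> fin_cases j <;>
      simp [n₀₁, n₁₂, n₂₃, n₀₂, n₁₃, n₀₃, n₀₁.symm, n₁₂.symm, n₂₃.symm, n₀₂.symm, n₁₃.symm,
        n₀₃.symm]
  · change ∀ i : Fin 4, (![x₀, x₁, x₂, x₃] : Fin 4 → List X) i ∈ F (c x₀)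
    intro i
    fin_cases i
    · exact hc x₀ h₀.1
    · exact e₀ ▸ hc x₁ h₁.1
    · exact (e₀.trans e₁) ▸ hc x₂ h₂.1
    · exact (e₀.trans (e₁.trans e₂)) ▸ hc x₃ h₂.2.1
  · change ∀ i : Fin 4, (shiftDigraph X n hn).Arc ((![x₀, x₁, x₂, x₃] : Fin 4 → List X) i)
      ((![x₀, x₁, x₂, x₃] : Fin 4 → List X) (i + 1))
    intro i
    fin_cases i
    · exact ⟨h₀.1, h₁.1, Or.inl h₀.2.2⟩
    · exact ⟨h₁.1, h₂.1, Or.inl h₁.2.2⟩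
    · exact ⟨h₂.1, h₂.2.1, Or.inl h₂.2.2⟩
    · exact ⟨h₂.2.1, h₀.1, Or.inr s₀₃⟩

/-- The underlying undirected graph of a digraph. -/
def underlying {W : Type v} (F : Digraph' W) : SimpleGraph W where
  Adj x y := F.Arc x y ∨ F.Arc y x
  symm := ⟨fun _ _ h => h.symm⟩
  loopless := ⟨fun x h => F.irrefl' x (h.elim id id)⟩

lemma isDisplaced_of_walk {W : Type v} {F : Digraph' W} {X : Type u} [LinearOrder X] {n : ℕ}
    {hn : 12 < n} {f : W → List X}
    (hf : ∀ ⦃a b : W⦄, F.Arc a b → (shiftDigraph X n hn).Arc (f a) (f b)) {a b : W}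
    (p : F.underlying.Walk a b) :
    ∃ d : ℤ, |d| ≤ (3 * p.length : ℕ) ∧ (Odd d ↔ Odd p.length) ∧
      IsDisplaced n (3 * p.length) d (f a) (f b) := by
  induction p with
  | nil => exact ⟨0, by simp, by simp, fun i l _ _ hl => by rw [add_zero] at hl; congr 1; omega⟩
  | cons hadj p ih =>
    obtain ⟨d, hd, hodd, hdisp⟩ := ih
    obtain ⟨e, he, heodd, hedisp⟩ := shiftDigraph_adj_isDisplaced (hn := hn)
      (hadj.imp (fun h => hf h) (fun h => hf h))
    refine ⟨e + d, ?_, ?_, ?_⟩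
    · rw [SimpleGraph.Walk.length_cons]
      have := abs_add_le e d
      push_cast at hd ⊢
      linarith
    · rw [SimpleGraph.Walk.length_cons, Int.odd_add, Nat.odd_add_one, ← hodd]
      simp [heodd]
    · rw [SimpleGraph.Walk.length_cons, mul_add, mul_one, add_comm]
      exact hedisp.trans hdisp hd

end Digraph'

/-- If a digraph `F` embeds into every digraph with uncountable dichromatic number,
then the underlying undirected graph of `F` is bipartite. -/
theorem statement_13.{u, v} {W : Type v} (F : Digraph' W)
    (h : ∀ (V : Type u) (D : Digraph' V), D.UncountableDichromatic → F.Embeds D) :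
    ∃ c : W → Bool, ∀ u v : W, (F.Arc u v ∨ F.Arc v u) → c u ≠ c v := by
  have hcol : F.underlying.Colorable 2 := by
    rw [SimpleGraph.two_colorable_iff_forall_loop_even]
    intro a p
    by_contra hp
    rw [Nat.not_even_iff_odd] at hp
    obtain ⟨X, hX, hD⟩ := Digraph'.exists_uncountableDichromatic_shiftDigraph.{u}
      (6 * p.length + 13) (by omega)
    obtain ⟨f, -, -, hf⟩ := h _ _ hD
    obtain ⟨d, hd, hodd, hdisp⟩ := Digraph'.isDisplaced_of_walk hf p
    have hfa : (f a).length = 6 * p.length + 13 ∧ (f a).Pairwise (· < ·) := by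
      cases p with
      | nil => simp at hp
      | cons hadj q => exact hadj.elim (fun h => (hf h).1) (fun h => (hf h).2.1)
    have := hdisp.eq_zero hd (by omega) hfa.1 hfa.2
    rw [← hodd, this] at hp
    exact absurd hp (by decide)
  obtain ⟨C⟩ := hcol
  refine ⟨fun w => decide (C w = 0), fun a b hab hc => ?_⟩
  have hne : C a ≠ C b := C.valid hab
  simp only [decide_eq_decide] at hc
  omega
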